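/- Assume that U is a random element that is a measurable function of S_l for every l ∈ 𝓛_k (common beamforming CSI) and also a measurable function of (H, S). If v★ ∈ 𝒱_k attains the essential infimum of the family { MSE_k(v|U) : v ∈ 𝒱_k }, then v★ attains the supremum over 𝒱_k of the coherent-decoding ergodic rate R_k^coh(v) := E[log(1 + SINR_k^coh(v|U))], where the expectation is taken in [0, ∞]. -/

import Mathlib

open MeasureTheory ProbabilityTheory Matrix Finset
open scoped ENNReal ComplexConjugate MeasureTheory

noncomputable section

/-- The canonical uplink massive MIMO model with `K` users and `M = N·L` infrastructure
antennas partitioned into `L` groups of `N` antennas (rows indexed by `Fin L × Fin N`),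
with distributed CSI `S l` (the CSI of processing unit `l`) taking values in `𝓢 l`. -/
structure DistUplinkModel (Ω : Type*) [MeasureSpace Ω] (K N L : ℕ)
    (𝓢 : Fin L → Type*) [∀ l, MeasurableSpace (𝓢 l)] where
  x : Fin K → Ω → ℂ
  z : Ω → Fin L × Fin N → ℂ
  H : Ω → Fin L × Fin N → Fin K → ℂ
  S : ∀ l, Ω → 𝓢 l
  p : Ω → Fin K → ℝ
  hx_meas : ∀ j, Measurable (x j)
  hz_meas : Measurable z
  hH_meas : Measurable H
  hS_meas : ∀ l, Measurable (S l)
  hx_L2 : ∀ j, MemLp (x j) 2 ℙ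
  hz_L2 : ∀ i, MemLp (fun ω => z ω i) 2 ℙ
  hx_mean : ∀ j, ∫ ω, x j ω = 0
  hx_var : ∀ j, ∫ ω, ‖x j ω‖ ^ 2 = 1
  hz_mean : ∀ i, ∫ ω, z ω i = 0
  hz_cov : ∀ i i', ∫ ω, z ω i * conj (z ω i') = if i = i' then 1 else 0
  hp_nonneg : ∀ ω j, 0 ≤ p ω j
  hp_meas : Measurable[MeasurableSpace.comap (fun ω l => S l ω) inferInstance] p
  hp_bdd : ∃ C : ℝ, ∀ᵐ ω, ∀ j, p ω j ≤ C
  /-- `(x 0, …, x (K-1))`, `z` and the pair `(H, S)` are mutually independent. -/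
  hindep : iIndep (fun i : Fin K ⊕ Bool =>
    Sum.elim (fun j => MeasurableSpace.comap (x j) inferInstance)
      (fun b => if b then
          MeasurableSpace.comap (fun ω => (H ω, fun l => S l ω)) inferInstance
        else MeasurableSpace.comap z inferInstance) i) ℙ
  /-- `E[‖H Hᴴ‖_F²] < ∞`. -/
  hHHherm_L2 : Integrable (fun ω =>
    ∑ i, ∑ i', ‖(Matrix.of (H ω) * (Matrix.of (H ω))ᴴ) i i'‖ ^ 2)

namespace DistUplinkModel

variable {Ω : Type*} [MeasureSpace Ω] {K N L : ℕ} {𝓢 : Fin L → Type*}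
  [∀ l, MeasurableSpace (𝓢 l)]

/-- The σ-algebra `σ(S_l)` generated by the CSI of processing unit `l`. -/
def mS (Mo : DistUplinkModel Ω K N L 𝓢) (l : Fin L) : MeasurableSpace Ω :=
  MeasurableSpace.comap (Mo.S l) inferInstance

/-- The received uplink signal `r = ∑ j √(p j) • h j * x j + z`. -/
def r (Mo : DistUplinkModel Ω K N L 𝓢) (ω : Ω) : Fin L × Fin N → ℂ := fun i =>
  (∑ j, (Real.sqrt (Mo.p ω j) : ℂ) * Mo.H ω i j * Mo.x j ω) + Mo.z ω i

/-- `g j v = √(p j) h jᴴ v`. -/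
def g (Mo : DistUplinkModel Ω K N L 𝓢) (j : Fin K) (v : Ω → Fin L × Fin N → ℂ) (ω : Ω) : ℂ :=
  (Real.sqrt (Mo.p ω j) : ℂ) * ∑ i, conj (Mo.H ω i j) * v ω i

/-- `MSE k v = E[|x k − vᴴ r|²]`. -/
def MSE (Mo : DistUplinkModel Ω K N L 𝓢) (k : Fin K) (v : Ω → Fin L × Fin N → ℂ) : ℝ :=
  ∫ ω, ‖Mo.x k ω - ∑ i, conj (v ω i) * Mo.r ω i‖ ^ 2

/-- `MSE_k(v | U) = E[|x k − vᴴ r|² | U]`, as conditional expectation given the σ-algebra `m`. -/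
def MSEcond (Mo : DistUplinkModel Ω K N L 𝓢) (m : MeasurableSpace Ω) (k : Fin K)
    (v : Ω → Fin L × Fin N → ℂ) : Ω → ℝ :=
  ℙ[fun ω => ‖Mo.x k ω - ∑ i, conj (v ω i) * Mo.r ω i‖ ^ 2 | m]

/-- The use-and-then-forget SINR (with the convention `0/0 = 0`, which is automatic for real
division in Lean). -/
def SINR_UatF (Mo : DistUplinkModel Ω K N L 𝓢) (k : Fin K)
    (v : Ω → Fin L × Fin N → ℂ) : ℝ :=
  ‖∫ ω, Mo.g k v ω‖ ^ 2 /
    (((∫ ω, ‖Mo.g k v ω‖ ^ 2) - ‖∫ ω, Mo.g k v ω‖ ^ 2)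
      + (∑ j ∈ Finset.univ.erase k, ∫ ω, ‖Mo.g j v ω‖ ^ 2)
      + ∫ ω, ∑ i, ‖v ω i‖ ^ 2)

/-- The coherent-decoding conditional SINR given the σ-algebra `m` (generated by the decoder
side information), with the convention `0/0 = 0`. -/
def SINR_coh (Mo : DistUplinkModel Ω K N L 𝓢) (m : MeasurableSpace Ω) (k : Fin K)
    (v : Ω → Fin L × Fin N → ℂ) (ω : Ω) : ℝ :=
  ‖(ℙ[Mo.g k v | m]) ω‖ ^ 2 /
    (((ℙ[fun ω' => ‖Mo.g k v ω'‖ ^ 2 | m]) ω - ‖(ℙ[Mo.g k v | m]) ω‖ ^ 2)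
      + (∑ j ∈ Finset.univ.erase k, (ℙ[fun ω' => ‖Mo.g j v ω'‖ ^ 2 | m]) ω)
      + (ℙ[fun ω' => ∑ i, ‖v ω' i‖ ^ 2 | m]) ω)

/-- The information-constrained beamforming set `𝒱_k`: for `l` in the serving cluster `Lk`,
the block `v_l` is `σ(S_l)`-measurable with `E[‖v_l‖⁴] < ∞`, and `v_l = 0` a.s. otherwise. -/
def Vset (Mo : DistUplinkModel Ω K N L 𝓢) (Lk : Finset (Fin L)) :
    Set (Ω → Fin L × Fin N → ℂ) :=
  { v | (∀ l ∈ Lk,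
          Measurable[Mo.mS l] (fun ω (n : Fin N) => v ω (l, n)) ∧
          Integrable (fun ω => (∑ n, ‖v ω (l, n)‖ ^ 2) ^ 2)) ∧
        ∀ l ∉ Lk, ∀ᵐ ω, ∀ n, v ω (l, n) = 0 }

end DistUplinkModel

theorem aux_pullout {Ω : Type*} {m G F mΩ : MeasurableSpace Ω} {μ : Measure Ω}
    [IsProbabilityMeasure μ] (hmG : m ≤ G) (hG : G ≤ mΩ) (hF : F ≤ mΩ) (hind : Indep F G μ)
    {q w : Ω → ℂ} (hq : AEStronglyMeasurable[G] q μ) (hqi : Integrable q μ)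
    (hw : StronglyMeasurable[F] w) (hwi : Integrable w μ) :
    Integrable (fun ω => q ω * w ω) μ ∧
      μ[fun ω => q ω * w ω | m] =ᵐ[μ] μ[fun ω => q ω * ∫ ω', w ω' ∂μ | m] := by
  have hint : Integrable (fun ω => q ω * w ω) μ := by
    obtain ⟨q', hq'm, hqq'⟩ := hq
    have hi : IndepFun q' w μ := by
      rw [IndepFun_iff_Indep]
      exact indep_of_indep_of_le_left (indep_of_indep_of_le_right hind.symm
        (measurable_iff_comap_le.1 hw.measurable)) (measurable_iff_comap_le.1 hq'm.measurable)
    have := hi.integrable_mul (hqi.congr hqq') hwi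
    refine this.congr ?_
    filter_upwards [hqq'] with ω h
    simp [h]
  refine ⟨hint, ?_⟩
  have h1 : μ[fun ω => q ω * w ω | G] =ᵐ[μ] fun ω => q ω * ∫ ω', w ω' ∂μ := by
    have := condExp_bilin_of_aestronglyMeasurable_left (ContinuousLinearMap.mul ℝ ℂ) hq
      (by simpa using hint) hwi
    have h2 := condExp_indep_eq (μ := μ) hF hG hw hind
    filter_upwards [this, h2] with ω h3 h4
    simp only [ContinuousLinearMap.mul_apply'] at h3
    rw [h3, h4]
  exact (condExp_condExp_of_le hmG hG).symm.trans (condExp_congr_ae h1)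

theorem aux_quad {Ω ι : Type*} [Fintype ι] [DecidableEq ι] {m G F mΩ : MeasurableSpace Ω}
    {μ : Measure Ω}
    [IsProbabilityMeasure μ] (hmG : m ≤ G) (hG : G ≤ mΩ) (hF : F ≤ mΩ) (hind : Indep F G μ)
    {b y : ι → Ω → ℂ} (hb : ∀ s, AEStronglyMeasurable[G] (b s) μ) (hb2 : ∀ s, MemLp (b s) 2 μ)
    (hy : ∀ s, StronglyMeasurable[F] (y s)) (hy2 : ∀ s, MemLp (y s) 2 μ)
    (horth : ∀ s t, ∫ ω, y s ω * conj (y t ω) ∂μ = if s = t then 1 else 0) :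
    μ[fun ω => ‖∑ s, b s ω * y s ω‖ ^ 2 | m] =ᵐ[μ] μ[fun ω => ∑ s, ‖b s ω‖ ^ 2 | m] := by
  have hconj : ∀ {f : Ω → ℂ}, MemLp f 2 μ → MemLp (fun ω => conj (f ω)) 2 μ := fun h => h.star
  have hq : ∀ s t, AEStronglyMeasurable[G] (fun ω => b s ω * conj (b t ω)) μ := fun s t =>
    (hb s).mul (Complex.continuous_conj.comp_aestronglyMeasurable (hb t))
  have hqi : ∀ s t, Integrable (fun ω => b s ω * conj (b t ω)) μ := fun s t =>
    (hb2 s).integrable_mul (hconj (hb2 t))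
  have hw : ∀ s t, StronglyMeasurable[F] (fun ω => y s ω * conj (y t ω)) := fun s t =>
    (hy s).mul (Complex.continuous_conj.comp_stronglyMeasurable (hy t))
  have hwi : ∀ s t, Integrable (fun ω => y s ω * conj (y t ω)) μ := fun s t =>
    (hy2 s).integrable_mul (hconj (hy2 t))
  have key := fun s t => aux_pullout hmG hG hF hind (hq s t) (hqi s t) (hw s t) (hwi s t)
  set f1 : Ω → ℂ := ∑ st : ι × ι, fun ω =>
    (b st.1 ω * conj (b st.2 ω)) * (y st.1 ω * conj (y st.2 ω)) with hf1
  set f2 : Ω → ℂ := ∑ st : ι × ι, fun ω =>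
    (b st.1 ω * conj (b st.2 ω)) * ∫ ω', y st.1 ω' * conj (y st.2 ω') ∂μ with hf2
  have hi1 : Integrable f1 μ := integrable_finsetSum' _ fun st _ => (key st.1 st.2).1
  have hi2 : Integrable f2 μ := integrable_finsetSum' _ fun st _ => (hqi st.1 st.2).mul_const _
  have h12 : μ[f1 | m] =ᵐ[μ] μ[f2 | m] := by
    have e1 := condExp_finsetSum (μ := μ) (m := m) (s := Finset.univ)
      (f := fun (st : ι × ι) ω => (b st.1 ω * conj (b st.2 ω)) * (y st.1 ω * conj (y st.2 ω)))
      (fun st _ => (key st.1 st.2).1)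
    have e2 := condExp_finsetSum (μ := μ) (m := m) (s := Finset.univ)
      (f := fun (st : ι × ι) ω => (b st.1 ω * conj (b st.2 ω)) *
        ∫ ω', y st.1 ω' * conj (y st.2 ω') ∂μ)
      (fun st _ => (hqi st.1 st.2).mul_const _)
    have e3 : ∀ᵐ ω ∂μ, ∀ st : ι × ι, _ := ae_all_iff.2 fun st : ι × ι => (key st.1 st.2).2
    filter_upwards [e1, e2, e3] with ω g1 g2 g3
    rw [hf1, hf2, g1, g2, Finset.sum_apply, Finset.sum_apply]
    exact Finset.sum_congr rfl fun st _ => g3 st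
  have r1 := Complex.reCLM.comp_condExp_comm (m := m) hi1
  have r2 := Complex.reCLM.comp_condExp_comm (m := m) hi2
  have s1 : Complex.reCLM ∘ f1 = fun ω => ‖∑ s, b s ω * y s ω‖ ^ 2 := by
    funext ω
    have : f1 ω = ((‖∑ s, b s ω * y s ω‖ ^ 2 : ℝ) : ℂ) := by
      rw [hf1, Finset.sum_apply, Fintype.sum_prod_type]
      push_cast
      rw [← Complex.mul_conj', map_sum, Finset.sum_mul_sum]
      refine Finset.sum_congr rfl fun s _ => Finset.sum_congr rfl fun t _ => ?_
      rw [map_mul]; ring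
    simp only [Function.comp_apply, Complex.reCLM_apply, this, Complex.ofReal_re]
  have s2 : Complex.reCLM ∘ f2 = fun ω => ∑ s, ‖b s ω‖ ^ 2 := by
    funext ω
    have : f2 ω = ((∑ s, ‖b s ω‖ ^ 2 : ℝ) : ℂ) := by
      rw [hf2, Finset.sum_apply, Fintype.sum_prod_type]
      push_cast
      refine Finset.sum_congr rfl fun s _ => ?_
      simp only [horth]
      simp [Complex.mul_conj']
    simp only [Function.comp_apply, Complex.reCLM_apply, this, Complex.ofReal_re]
  rw [s1] at r1
  rw [s2] at r2
  filter_upwards [h12, r1, r2] with ω h a1 a2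
  rw [← a1, ← a2, Function.comp_apply, Function.comp_apply, h]
theorem aux_aesm_sum {Ω ι : Type*} {G mΩ : MeasurableSpace Ω} {μ : Measure Ω} {f : ι → Ω → ℂ}
    (s : Finset ι) (h : ∀ i, AEStronglyMeasurable[G] (f i) μ) :
    AEStronglyMeasurable[G] (fun ω => ∑ i ∈ s, f i ω) μ := by
  classical
  induction s using Finset.induction_on with
  | empty => simpa using (stronglyMeasurable_const (b := (0:ℂ))).aestronglyMeasurable
  | insert a s ha ih =>
    simp only [Finset.sum_insert ha]
    exact (h a).add ih

theorem aux_term {Ω : Type*} {mΩ : MeasurableSpace Ω} {μ : Measure Ω} [IsFiniteMeasure μ]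
    {a h v : Ω → ℂ} {C : ℝ} (ha : AEStronglyMeasurable a μ) (hh : AEStronglyMeasurable h μ)
    (hv : AEStronglyMeasurable v μ)
    (hC : ∀ᵐ ω ∂μ, ‖a ω‖ ^ 2 ≤ C) (hhi : Integrable (fun ω => ‖h ω‖ ^ 4) μ)
    (hvi : Integrable (fun ω => ‖v ω‖ ^ 4) μ) : MemLp (fun ω => a ω * (h ω * v ω)) 2 μ := by
  have hm : AEStronglyMeasurable (fun ω => a ω * (h ω * v ω)) μ := ha.mul (hh.mul hv)
  rw [memLp_two_iff_integrable_sq_norm hm]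
  refine Integrable.mono' ((hhi.add hvi).const_mul C) ?_ ?_
  · exact hm.norm.pow 2
  · filter_upwards [hC] with ω hC
    simp only [norm_mul, norm_pow, norm_norm, Pi.add_apply, mul_pow]
    have h0 := sq_nonneg ‖a ω‖
    have h1 : ‖h ω‖ ^ 2 * ‖v ω‖ ^ 2 ≤ ‖h ω‖ ^ 4 + ‖v ω‖ ^ 4 := by
      nlinarith [sq_nonneg (‖h ω‖ ^ 2 - ‖v ω‖ ^ 2), sq_nonneg (‖h ω‖ ^ 2), sq_nonneg (‖v ω‖ ^ 2)]
    exact mul_le_mul hC h1 (by positivity) (h0.trans hC)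

theorem aux_L2_of_L4 {Ω : Type*} {mΩ : MeasurableSpace Ω} {μ : Measure Ω} [IsFiniteMeasure μ]
    {v : Ω → ℂ} (hv : AEStronglyMeasurable v μ)
    (hvi : Integrable (fun ω => ‖v ω‖ ^ 4) μ) : MemLp v 2 μ := by
  rw [memLp_two_iff_integrable_sq_norm hv]
  refine Integrable.mono' ((integrable_const (1:ℝ)).add hvi) (hv.norm.pow 2) (ae_of_all _ fun ω => ?_)
  simp only [norm_pow, norm_norm, Pi.add_apply]
  nlinarith [sq_nonneg (‖v ω‖ ^ 2 - 1)]

namespace DistUplinkModel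

variable {Ω : Type*} [MeasureSpace Ω] [IsProbabilityMeasure (ℙ : Measure Ω)]
  {K N L : ℕ} {𝓢 : Fin L → Type*}
  [∀ l, MeasurableSpace (𝓢 l)]

/-- The σ-algebra of `(H, S)`. -/
def mG (Mo : DistUplinkModel Ω K N L 𝓢) : MeasurableSpace Ω :=
  MeasurableSpace.comap (fun ω => (Mo.H ω, fun l => Mo.S l ω)) inferInstance

theorem mG_le (Mo : DistUplinkModel Ω K N L 𝓢) : Mo.mG ≤ MeasureSpace.toMeasurableSpace :=
  measurable_iff_comap_le.1 (Mo.hH_meas.prodMk (measurable_pi_lambda _ Mo.hS_meas))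

theorem meas_mG (Mo : DistUplinkModel Ω K N L 𝓢) :
    Measurable[Mo.mG] (fun ω => (Mo.H ω, fun l => Mo.S l ω)) := comap_measurable _

theorem H_mG (Mo : DistUplinkModel Ω K N L 𝓢) (i : Fin L × Fin N) (j : Fin K) :
    Measurable[Mo.mG] (fun ω => Mo.H ω i j) := by
  have : Measurable (fun q : (Fin L × Fin N → Fin K → ℂ) × (∀ l, 𝓢 l) => q.1 i j) := by fun_prop
  exact this.comp Mo.meas_mG

theorem mS_le_mG (Mo : DistUplinkModel Ω K N L 𝓢) (l : Fin L) : Mo.mS l ≤ Mo.mG := by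
  have : Measurable (fun q : (Fin L × Fin N → Fin K → ℂ) × (∀ l, 𝓢 l) => q.2 l) := by fun_prop
  exact measurable_iff_comap_le.1 (this.comp Mo.meas_mG)

theorem p_mG (Mo : DistUplinkModel Ω K N L 𝓢) (j : Fin K) :
    Measurable[Mo.mG] (fun ω => Mo.p ω j) := by
  have : Measurable (fun q : (Fin L × Fin N → Fin K → ℂ) × (∀ l, 𝓢 l) => q.2) := by fun_prop
  have h2 : MeasurableSpace.comap (fun ω l => Mo.S l ω) inferInstance ≤ Mo.mG :=
    measurable_iff_comap_le.1 (this.comp Mo.meas_mG)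
  exact (measurable_pi_apply j).comp (Mo.hp_meas.mono h2 le_rfl)

theorem v_mG (Mo : DistUplinkModel Ω K N L 𝓢) {Lk : Finset (Fin L)}
    {v : Ω → Fin L × Fin N → ℂ} (hv : v ∈ Mo.Vset Lk) (i : Fin L × Fin N) :
    AEStronglyMeasurable[Mo.mG] (fun ω => v ω i) ℙ := by
  obtain ⟨l, n⟩ := i
  by_cases hl : l ∈ Lk
  · have h1 : Measurable[Mo.mG] (fun ω => v ω (l, n)) :=
      (measurable_pi_apply n).comp ((hv.1 l hl).1.mono (Mo.mS_le_mG l) le_rfl)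
    exact h1.stronglyMeasurable.aestronglyMeasurable
  · refine ⟨fun _ => 0, stronglyMeasurable_const, ?_⟩
    filter_upwards [hv.2 l hl] with ω h using h n

theorem v_L4 (Mo : DistUplinkModel Ω K N L 𝓢) {Lk : Finset (Fin L)}
    {v : Ω → Fin L × Fin N → ℂ} (hv : v ∈ Mo.Vset Lk) (i : Fin L × Fin N) :
    Integrable (fun ω => ‖v ω i‖ ^ 4) := by
  have hm := ((Mo.v_mG hv i).mono Mo.mG_le).norm.pow 4
  obtain ⟨l, n⟩ := i
  by_cases hl : l ∈ Lk
  · refine Integrable.mono' (hv.1 l hl).2 hm (ae_of_all _ fun ω => ?_)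
    have : ‖v ω (l, n)‖ ^ 2 ≤ ∑ n, ‖v ω (l, n)‖ ^ 2 :=
      Finset.single_le_sum (f := fun n => ‖v ω (l, n)‖ ^ 2) (fun _ _ => sq_nonneg _) (Finset.mem_univ n)
    have h2 := pow_le_pow_left₀ (sq_nonneg _) this 2
    simpa [← pow_mul] using h2
  · refine (integrable_zero Ω ℝ ℙ).congr ?_
    filter_upwards [hv.2 l hl] with ω h
    simp [h n]

theorem v_L2 (Mo : DistUplinkModel Ω K N L 𝓢) {Lk : Finset (Fin L)}
    {v : Ω → Fin L × Fin N → ℂ} (hv : v ∈ Mo.Vset Lk) (i : Fin L × Fin N) :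
    MemLp (fun ω => v ω i) 2 :=
  aux_L2_of_L4 ((Mo.v_mG hv i).mono Mo.mG_le) (Mo.v_L4 hv i)

theorem H_L4 (Mo : DistUplinkModel Ω K N L 𝓢) (i : Fin L × Fin N) (j : Fin K) :
    Integrable (fun ω => ‖Mo.H ω i j‖ ^ 4) := by
  have hm : AEStronglyMeasurable (fun ω => ‖Mo.H ω i j‖ ^ 4) ℙ :=
    (((Mo.H_mG i j).mono Mo.mG_le le_rfl).norm.pow_const 4).aestronglyMeasurable
  refine Integrable.mono' Mo.hHHherm_L2 hm (ae_of_all _ fun ω => ?_)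
  have h0 : (Matrix.of (Mo.H ω) * (Matrix.of (Mo.H ω))ᴴ) i i =
      ((∑ j, ‖Mo.H ω i j‖ ^ 2 : ℝ) : ℂ) := by
    simp [Matrix.mul_apply, Complex.mul_conj']
  have h1 : ‖Mo.H ω i j‖ ^ 2 ≤ ‖(Matrix.of (Mo.H ω) * (Matrix.of (Mo.H ω))ᴴ) i i‖ := by
    rw [h0, Complex.norm_real, Real.norm_of_nonneg (Finset.sum_nonneg fun _ _ => sq_nonneg _)]
    exact Finset.single_le_sum (f := fun j => ‖Mo.H ω i j‖ ^ 2) (fun _ _ => sq_nonneg _) (Finset.mem_univ j)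
  have h2 : ‖(Matrix.of (Mo.H ω) * (Matrix.of (Mo.H ω))ᴴ) i i‖ ^ 2 ≤
      ∑ i, ∑ i', ‖(Matrix.of (Mo.H ω) * (Matrix.of (Mo.H ω))ᴴ) i i'‖ ^ 2 := by
    refine le_trans ?_ (Finset.single_le_sum
      (f := fun i => ∑ i', ‖(Matrix.of (Mo.H ω) * (Matrix.of (Mo.H ω))ᴴ) i i'‖ ^ 2)
      (fun _ _ => Finset.sum_nonneg fun _ _ => sq_nonneg _) (Finset.mem_univ i))
    exact (Finset.single_le_sum
      (f := fun i' => ‖(Matrix.of (Mo.H ω) * (Matrix.of (Mo.H ω))ᴴ) i i'‖ ^ 2)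
      (fun _ _ => sq_nonneg _) (Finset.mem_univ i))
  have h3 := pow_le_pow_left₀ (sq_nonneg _) h1 2
  refine le_trans ?_ (h3.trans h2)
  simp [← pow_mul]

theorem sqrtp_mG (Mo : DistUplinkModel Ω K N L 𝓢) (j : Fin K) :
    Measurable[Mo.mG] (fun ω => (Real.sqrt (Mo.p ω j) : ℂ)) :=
  Complex.measurable_ofReal.comp (Real.continuous_sqrt.measurable.comp (Mo.p_mG j))

theorem g_mG (Mo : DistUplinkModel Ω K N L 𝓢) {Lk : Finset (Fin L)}
    {v : Ω → Fin L × Fin N → ℂ} (hv : v ∈ Mo.Vset Lk) (j : Fin K) :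
    AEStronglyMeasurable[Mo.mG] (Mo.g j v) ℙ := by
  have h1 : ∀ i, AEStronglyMeasurable[Mo.mG] (fun ω => conj (Mo.H ω i j) * v ω i) ℙ := fun i =>
    (Complex.continuous_conj.comp_stronglyMeasurable
      (Mo.H_mG i j).stronglyMeasurable).aestronglyMeasurable.mul (Mo.v_mG hv i)
  exact (Mo.sqrtp_mG j).stronglyMeasurable.aestronglyMeasurable.mul
    (aux_aesm_sum _ h1)

theorem g_L2 (Mo : DistUplinkModel Ω K N L 𝓢) {Lk : Finset (Fin L)}
    {v : Ω → Fin L × Fin N → ℂ} (hv : v ∈ Mo.Vset Lk) (j : Fin K) :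
    MemLp (Mo.g j v) 2 := by
  obtain ⟨C, hC⟩ := Mo.hp_bdd
  have h1 : ∀ i, MemLp (fun ω => (Real.sqrt (Mo.p ω j) : ℂ) * (conj (Mo.H ω i j) * v ω i)) 2 := by
    intro i
    refine aux_term (C := C) ((Mo.sqrtp_mG j).mono Mo.mG_le le_rfl).aestronglyMeasurable
      (Complex.continuous_conj.comp_aestronglyMeasurable
        ((Mo.H_mG i j).mono Mo.mG_le le_rfl).aestronglyMeasurable)
      ((Mo.v_mG hv i).mono Mo.mG_le) ?_ ?_ (Mo.v_L4 hv i)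
    · filter_upwards [hC] with ω h
      rw [Complex.norm_real, Real.norm_of_nonneg (Real.sqrt_nonneg _),
        Real.sq_sqrt (Mo.hp_nonneg ω j)]
      exact h j
    · simpa using Mo.H_L4 i j
  have h2 := memLp_finsetSum Finset.univ fun i (_ : i ∈ Finset.univ) => h1 i
  convert h2 using 1
  funext ω
  simp [g, Finset.mul_sum]

/-- The σ-algebra of the symbols and the noise. -/
def mF (Mo : DistUplinkModel Ω K N L 𝓢) : MeasurableSpace Ω :=
  (⨆ j, MeasurableSpace.comap (Mo.x j) inferInstance) ⊔ MeasurableSpace.comap Mo.z inferInstance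

theorem mF_le (Mo : DistUplinkModel Ω K N L 𝓢) : Mo.mF ≤ MeasureSpace.toMeasurableSpace :=
  sup_le (iSup_le fun j => measurable_iff_comap_le.1 (Mo.hx_meas j))
    (measurable_iff_comap_le.1 Mo.hz_meas)

theorem x_mF (Mo : DistUplinkModel Ω K N L 𝓢) (j : Fin K) :
    StronglyMeasurable[Mo.mF] (Mo.x j) := by
  have h : MeasurableSpace.comap (Mo.x j) inferInstance ≤ Mo.mF :=
    le_sup_of_le_left (le_iSup (fun j => MeasurableSpace.comap (Mo.x j) inferInstance) j)
  have h2 : Measurable[Mo.mF] (Mo.x j) := (comap_measurable (Mo.x j)).mono h le_rfl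
  exact h2.stronglyMeasurable

theorem z_mF (Mo : DistUplinkModel Ω K N L 𝓢) (i : Fin L × Fin N) :
    StronglyMeasurable[Mo.mF] (fun ω => Mo.z ω i) := by
  have h : MeasurableSpace.comap Mo.z inferInstance ≤ Mo.mF := le_sup_right
  have h2 : Measurable[Mo.mF] Mo.z := (comap_measurable Mo.z).mono h le_rfl
  have h3 : Measurable[Mo.mF] (fun ω => Mo.z ω i) := (measurable_pi_apply i).comp h2
  exact h3.stronglyMeasurable

theorem indep_FG (Mo : DistUplinkModel Ω K N L 𝓢) : Indep Mo.mF Mo.mG ℙ := by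
  have := indep_iSup_of_disjoint (S := {i | i ≠ Sum.inr true}) (T := {Sum.inr true}) ?_ Mo.hindep ?_
  · refine indep_of_indep_of_le_left (indep_of_indep_of_le_right this ?_) ?_
    · simp [mG]
    · refine sup_le (iSup_le fun j => ?_) ?_
      · exact le_trans (by simp) (le_iSup₂ (Sum.inl j) (by simp))
      · exact le_trans (by simp) (le_iSup₂ (Sum.inr false) (by simp))
  · rintro (j | b)
    · exact measurable_iff_comap_le.1 (Mo.hx_meas j)
    · cases b
      · simpa using measurable_iff_comap_le.1 Mo.hz_meas
      · simpa [mG] using Mo.mG_le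
  · simp

/-- symbols and noise as one family -/
def y (Mo : DistUplinkModel Ω K N L 𝓢) : Fin K ⊕ (Fin L × Fin N) → Ω → ℂ :=
  Sum.elim Mo.x (fun i ω => Mo.z ω i)

theorem y_orth (Mo : DistUplinkModel Ω K N L 𝓢) (s t : Fin K ⊕ (Fin L × Fin N)) :
    ∫ ω, Mo.y s ω * conj (Mo.y t ω) = if s = t then 1 else 0 := by
  have hcj : ∀ f : Ω → ℂ, ∫ ω, conj (f ω) = conj (∫ ω, f ω) := fun f => integral_conj
  have hz : ∀ i, Measurable (fun ω => Mo.z ω i) := fun i => (measurable_pi_apply i).comp Mo.hz_meas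
  have zind : ∀ j i, IndepFun (Mo.x j) (fun ω => Mo.z ω i) ℙ := by
    intro j i
    have h1 : IndepFun (Mo.x j) Mo.z ℙ := by
      rw [IndepFun_iff_Indep]
      simpa using Mo.hindep.indep (i := Sum.inl j) (j := Sum.inr false) (by simp)
    exact h1.comp measurable_id (measurable_pi_apply i)
  rcases s with j | i <;> rcases t with j' | i'
  · by_cases h : j = j'
    · subst h
      simp only [y, Sum.elim_inl, if_true, Complex.mul_conj']
      have := Mo.hx_var j
      rw [← Complex.ofReal_one, ← this, ← integral_complex_ofReal]
      simp
    · have h1 : IndepFun (Mo.x j) (Mo.x j') ℙ := by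
        rw [IndepFun_iff_Indep]
        simpa using Mo.hindep.indep (i := Sum.inl j) (j := Sum.inl j') (by simpa using h)
      have h2 := h1.comp measurable_id Complex.continuous_conj.measurable
      have h3 := h2.integral_fun_mul_eq_mul_integral (Mo.hx_meas j).aestronglyMeasurable
        (Complex.continuous_conj.measurable.comp (Mo.hx_meas j')).aestronglyMeasurable
      simp only [Function.comp_apply, id] at h3
      simp [y, h, h3, Mo.hx_mean]
  · have h2 := (zind j i').comp measurable_id Complex.continuous_conj.measurable
    have h3 := h2.integral_fun_mul_eq_mul_integral (Mo.hx_meas j).aestronglyMeasurable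
      (Complex.continuous_conj.measurable.comp (hz i')).aestronglyMeasurable
    simp only [Function.comp_apply, id] at h3
    simp [y, h3, Mo.hx_mean]
  · have h2 := (zind j' i).symm.comp measurable_id Complex.continuous_conj.measurable
    have h3 := h2.integral_fun_mul_eq_mul_integral (hz i).aestronglyMeasurable
      (Complex.continuous_conj.measurable.comp (Mo.hx_meas j')).aestronglyMeasurable
    simp only [Function.comp_apply, id] at h3
    simp [y, h3, Mo.hz_mean]
  · simp [y, Mo.hz_cov]

/-- conditional total received power -/
def Dc (Mo : DistUplinkModel Ω K N L 𝓢) (m : MeasurableSpace Ω)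
    (v : Ω → Fin L × Fin N → ℂ) (ω : Ω) : ℝ :=
  (∑ j, (ℙ[fun ω' => ‖Mo.g j v ω'‖ ^ 2 | m]) ω) + (ℙ[fun ω' => ∑ i, ‖v ω' i‖ ^ 2 | m]) ω

theorem g_sq_int (Mo : DistUplinkModel Ω K N L 𝓢) {Lk : Finset (Fin L)}
    {v : Ω → Fin L × Fin N → ℂ} (hv : v ∈ Mo.Vset Lk) (j : Fin K) :
    Integrable (fun ω => ‖Mo.g j v ω‖ ^ 2) :=
  (memLp_two_iff_integrable_sq_norm (Mo.g_L2 hv j).1).1 (Mo.g_L2 hv j)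

theorem v_sq_int (Mo : DistUplinkModel Ω K N L 𝓢) {Lk : Finset (Fin L)}
    {v : Ω → Fin L × Fin N → ℂ} (hv : v ∈ Mo.Vset Lk) :
    Integrable (fun ω => ∑ i, ‖v ω i‖ ^ 2) :=
  integrable_finsetSum _ fun i _ =>
    (memLp_two_iff_integrable_sq_norm (Mo.v_L2 hv i).1).1 (Mo.v_L2 hv i)

theorem MSE_formula (Mo : DistUplinkModel Ω K N L 𝓢) {Lk : Finset (Fin L)} {m : MeasurableSpace Ω}
    (hm : m ≤ Mo.mG) (k : Fin K)
    {v : Ω → Fin L × Fin N → ℂ} (hv : v ∈ Mo.Vset Lk) :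
    Mo.MSEcond m k v =ᵐ[ℙ] fun ω => 1 - 2 * ((ℙ[Mo.g k v | m]) ω).re + Mo.Dc m v ω := by
  let b : Fin K ⊕ (Fin L × Fin N) → Ω → ℂ :=
    Sum.elim (fun j ω => (if j = k then 1 else 0) - conj (Mo.g j v ω))
      (fun i ω => - conj (v ω i))
  have hb : b = Sum.elim (fun j ω => (if j = k then 1 else 0) - conj (Mo.g j v ω))
      (fun i ω => - conj (v ω i)) := rfl
  have e0 : (fun ω => ‖Mo.x k ω - ∑ i, conj (v ω i) * Mo.r ω i‖ ^ 2) =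
      fun ω => ‖∑ s, b s ω * Mo.y s ω‖ ^ 2 := by
    funext ω
    congr 2
    have hA : ∑ i, conj (v ω i) * Mo.r ω i =
        (∑ j, conj (Mo.g j v ω) * Mo.x j ω) + ∑ i, conj (v ω i) * Mo.z ω i := by
      simp only [r, g, mul_add, Finset.sum_add_distrib, map_mul, map_sum, Complex.conj_conj,
        Complex.conj_ofReal, Finset.mul_sum, Finset.sum_mul]
      rw [Finset.sum_comm]
      congr 1
      refine Finset.sum_congr rfl fun _ _ => Finset.sum_congr rfl fun _ _ => ?_
      ring
    rw [hA, Fintype.sum_sum_type]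
    simp only [hb, Sum.elim_inl, Sum.elim_inr, y, sub_mul,
      Finset.sum_sub_distrib, ite_mul, one_mul, zero_mul, Finset.sum_ite_eq', Finset.mem_univ,
      if_true, neg_mul, Finset.sum_neg_distrib]
    ring
  have hconj : ∀ {f : Ω → ℂ}, MemLp f 2 ℙ → MemLp (fun ω => conj (f ω)) 2 ℙ := fun h => h.star
  have e1 : Mo.MSEcond m k v =ᵐ[ℙ] ℙ[fun ω => ∑ s, ‖b s ω‖ ^ 2 | m] := by
    unfold MSEcond
    rw [e0]
    refine aux_quad hm Mo.mG_le Mo.mF_le Mo.indep_FG ?_ ?_ ?_ ?_ Mo.y_orth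
    · rintro (j | i)
      · exact aestronglyMeasurable_const.sub
          (Complex.continuous_conj.comp_aestronglyMeasurable (Mo.g_mG hv j))
      · exact (Complex.continuous_conj.comp_aestronglyMeasurable (Mo.v_mG hv i)).neg
    · rintro (j | i)
      · exact (memLp_const _).sub (hconj (Mo.g_L2 hv j))
      · exact (hconj (Mo.v_L2 hv i)).neg
    · rintro (j | i)
      · exact Mo.x_mF j
      · exact Mo.z_mF i
    · rintro (j | i)
      · exact Mo.hx_L2 j
      · exact Mo.hz_L2 i
  have hgk : Integrable (Mo.g k v) := (Mo.g_L2 hv k).integrable (by norm_num)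
  have e2 : (fun ω => ∑ s, ‖b s ω‖ ^ 2) = ((fun _ => (1:ℝ)) - (2:ℝ) • (Complex.reCLM ∘ Mo.g k v)) +
      ((∑ j, fun ω => ‖Mo.g j v ω‖ ^ 2) + fun ω => ∑ i, ‖v ω i‖ ^ 2) := by
    funext ω
    have h1 : ∀ j, ‖(if j = k then (1:ℂ) else 0) - conj (Mo.g j v ω)‖ ^ 2 =
        (if j = k then 1 - 2 * (Mo.g k v ω).re else 0) + ‖Mo.g j v ω‖ ^ 2 := by
      intro j
      split_ifs with h
      · subst h
        rw [← Complex.normSq_eq_norm_sq, ← Complex.normSq_eq_norm_sq, Complex.normSq_apply, Complex.normSq_apply]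
        simp; ring
      · simp
    simp only [Fintype.sum_sum_type, hb, Sum.elim_inl, Sum.elim_inr, h1, Finset.sum_add_distrib]
    simp [add_assoc]
  have hre : Integrable (Complex.reCLM ∘ Mo.g k v) := Complex.reCLM.integrable_comp hgk
  have i1 : Integrable ((2:ℝ) • (Complex.reCLM ∘ Mo.g k v)) := hre.smul _
  have i2 : Integrable (∑ j, fun ω => ‖Mo.g j v ω‖ ^ 2) :=
    integrable_finsetSum' _ fun j _ => Mo.g_sq_int hv j
  rw [e2] at e1
  have a1 := condExp_add ((integrable_const (μ := ℙ) (1:ℝ)).sub i1)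
    (i2.add (Mo.v_sq_int hv)) m
  have a2 := condExp_sub (integrable_const (μ := ℙ) (1:ℝ)) i1 m
  have a3 := condExp_add i2 (Mo.v_sq_int hv) m
  have a4 := condExp_finsetSum (m := m) (s := Finset.univ) fun j _ => Mo.g_sq_int hv j
  have a5 := condExp_smul (μ := ℙ) (2:ℝ) (Complex.reCLM ∘ Mo.g k v) m
  have a6 := Complex.reCLM.comp_condExp_comm (m := m) hgk
  filter_upwards [e1, a1, a2, a3, a4, a5, a6] with ω e1 a1 a2 a3 a4 a5 a6
  rw [e1, a1, Pi.add_apply, a2, a3, Pi.sub_apply, Pi.add_apply, a4, a5, Pi.smul_apply, ← a6,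
    condExp_const (hm.trans Mo.mG_le)]
  simp [Dc]

end DistUplinkModel

theorem aux_real {A D A' D' a' T : ℝ} (hAD : A < D ∨ (A = 0 ∧ D = 0)) (hA : 0 ≤ A) (hA' : 0 ≤ A')
    (hAD' : A' < D' ∨ (A' = 0 ∧ D' = 0)) (ha' : a' ^ 2 ≤ A')
    (h1 : 1 - 2 * a' + D' ≤ T) (h2 : T = 1 - A / D) :
    A / (D - A) ≤ A' / (D' - A') := by
  rcases hAD with hAD | ⟨rfl, rfl⟩
  swap
  · have : 0 ≤ D' - A' := by rcases hAD' with h | ⟨h, h'⟩ <;> linarith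
    simpa using div_nonneg hA' this
  have hD : 0 < D := lt_of_le_of_lt hA hAD
  rcases hAD' with hAD' | ⟨rfl, rfl⟩
  · have hD' : 0 < D' := lt_of_le_of_lt hA' hAD'
    have h3 : 2 * a' - D' ≤ A' / D' := by
      rw [le_div_iff₀ hD']
      nlinarith [sq_nonneg (a' - D')]
    have h4 : A / D ≤ A' / D' := by linarith
    rw [div_le_div_iff₀ hD hD'] at h4
    rw [div_le_div_iff₀ (by linarith) (by linarith)]
    nlinarith
  · have : a' = 0 := by nlinarith [sq_nonneg a']
    subst this
    have h4 : A / D ≤ 0 := by linarith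
    have h5 : A ≤ 0 := by
      rwa [div_le_iff₀ hD, zero_mul] at h4
    have : A = 0 := le_antisymm h5 hA
    simp [this]

namespace DistUplinkModel

variable {Ω : Type*} [MeasureSpace Ω] [IsProbabilityMeasure (ℙ : Measure Ω)]
  {K N L : ℕ} {𝓢 : Fin L → Type*}
  [∀ l, MeasurableSpace (𝓢 l)]

theorem SINR_eq (Mo : DistUplinkModel Ω K N L 𝓢) (m : MeasurableSpace Ω) (k : Fin K)
    (v : Ω → Fin L × Fin N → ℂ) (ω : Ω) : Mo.SINR_coh m k v ω =
      ‖(ℙ[Mo.g k v | m]) ω‖ ^ 2 / (Mo.Dc m v ω - ‖(ℙ[Mo.g k v | m]) ω‖ ^ 2) := by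
  unfold SINR_coh Dc
  rw [← Finset.add_sum_erase Finset.univ
    (fun j => (ℙ[fun ω' => ‖Mo.g j v ω'‖ ^ 2 | m]) ω) (Finset.mem_univ k)]
  congr 1
  ring

theorem D_dich (Mo : DistUplinkModel Ω K N L 𝓢) {Lk : Finset (Fin L)} {m : MeasurableSpace Ω}
    (hm : m ≤ MeasureSpace.toMeasurableSpace) (k : Fin K)
    {v : Ω → Fin L × Fin N → ℂ} (hv : v ∈ Mo.Vset Lk) :
    ∀ᵐ ω, ‖(ℙ[Mo.g k v | m]) ω‖ ^ 2 < Mo.Dc m v ω ∨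
      (‖(ℙ[Mo.g k v | m]) ω‖ ^ 2 = 0 ∧ Mo.Dc m v ω = 0) := by
  have h1 : ∀ᵐ ω, ∀ j, 0 ≤ (ℙ[fun ω' => ‖Mo.g j v ω'‖ ^ 2 | m]) ω := ae_all_iff.2 fun j =>
    condExp_nonneg (ae_of_all _ fun ω => sq_nonneg _)
  have h2 : ∀ᵐ ω, 0 ≤ (ℙ[fun ω' => ∑ i, ‖v ω' i‖ ^ 2 | m]) ω :=
    condExp_nonneg (ae_of_all _ fun ω => Finset.sum_nonneg fun _ _ => sq_nonneg _)
  have h3 : ∀ᵐ ω, ‖(ℙ[Mo.g k v | m]) ω‖ ^ 2 ≤ (ℙ[fun ω' => ‖Mo.g k v ω'‖ ^ 2 | m]) ω := by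
    have := Integrable.norm_condExp_rpow_le (m := m) (f := Mo.g k v) (μ := ℙ) (p := 2) (by norm_num)
      (by simpa using Mo.g_sq_int hv k)
    simp only [Real.rpow_two] at this
    exact this
  set A : Set Ω := {ω | (ℙ[fun ω' => ∑ i, ‖v ω' i‖ ^ 2 | m]) ω = 0} with hA
  have hAm : MeasurableSet[m] A :=
    (stronglyMeasurable_condExp (m := m)).measurable (measurableSet_singleton (0:ℝ))
  have h4 : ∀ᵐ ω, ω ∈ A → ∀ i, v ω i = 0 := by
    have e1 : ∫ ω in A, ∑ i, ‖v ω i‖ ^ 2 = 0 := by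
      rw [← setIntegral_condExp hm (Mo.v_sq_int hv) hAm]
      exact setIntegral_eq_zero_of_forall_eq_zero fun ω hω => hω
    rw [setIntegral_eq_zero_iff_of_nonneg_ae
      (ae_of_all _ fun ω => Finset.sum_nonneg fun _ _ => sq_nonneg _)
      (Mo.v_sq_int hv).integrableOn] at e1
    have e2 := (ae_restrict_iff' (hm _ hAm)).1 e1
    filter_upwards [e2] with ω h hω i
    have h5 := h hω
    simp only [Pi.zero_apply] at h5
    rw [Finset.sum_eq_zero_iff_of_nonneg (fun _ _ => sq_nonneg _)] at h5
    simpa using h5 i (Finset.mem_univ i)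
  have h5 : ∀ᵐ ω, ∀ j, ω ∈ A → (ℙ[fun ω' => ‖Mo.g j v ω'‖ ^ 2 | m]) ω = 0 := by
    refine ae_all_iff.2 fun j => ?_
    have e1 := condExp_ae_eq_restrict_zero (μ := ℙ) (f := fun ω' => ‖Mo.g j v ω'‖ ^ 2) hAm (by
      refine (ae_restrict_iff' (hm _ hAm)).2 ?_
      filter_upwards [h4] with ω h hω
      simp [g, h hω])
    exact (ae_restrict_iff' (hm _ hAm)).1 e1
  filter_upwards [h1, h2, h3, h5] with ω h1 h2 h3 h5
  have h6 : (ℙ[fun ω' => ‖Mo.g k v ω'‖ ^ 2 | m]) ω ≤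
      ∑ j, (ℙ[fun ω' => ‖Mo.g j v ω'‖ ^ 2 | m]) ω :=
    Finset.single_le_sum (f := fun j => (ℙ[fun ω' => ‖Mo.g j v ω'‖ ^ 2 | m]) ω)
      (fun j _ => h1 j) (Finset.mem_univ k)
  rcases h2.lt_or_eq with h | h
  · left
    unfold Dc
    linarith
  · right
    have h7 := fun j => h5 j h.symm
    refine ⟨le_antisymm (h3.trans (h7 k).le) (sq_nonneg _), ?_⟩
    unfold Dc
    rw [← h]
    simp [h7]

theorem scale_mem (Mo : DistUplinkModel Ω K N L 𝓢) {Lk : Finset (Fin L)} {m : MeasurableSpace Ω}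
    (hm : m ≤ MeasureSpace.toMeasurableSpace) (hmS : ∀ l ∈ Lk, m ≤ Mo.mS l)
    {v : Ω → Fin L × Fin N → ℂ} (hv : v ∈ Mo.Vset Lk) {c : Ω → ℂ} (hc : Measurable[m] c)
    {R : ℝ} (hR : ∀ ω, ‖c ω‖ ≤ R) : (fun ω i => c ω * v ω i) ∈ Mo.Vset Lk := by
  refine ⟨fun l hl => ⟨?_, ?_⟩, fun l hl => ?_⟩
  · have h1 : Measurable[Mo.mS l] c := hc.mono (hmS l hl) le_rfl
    have h2 : ∀ n, Measurable[Mo.mS l] fun ω => v ω (l, n) := fun n =>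
      (measurable_pi_apply n).comp (hv.1 l hl).1
    exact @measurable_pi_lambda _ _ _ (Mo.mS l) _ _ fun n => h1.mul (h2 n)
  · have h3 : (fun ω => (∑ n, ‖c ω * v ω (l, n)‖ ^ 2) ^ 2) =
        fun ω => ‖c ω‖ ^ 4 * (∑ n, ‖v ω (l, n)‖ ^ 2) ^ 2 := by
      funext ω
      simp only [norm_mul, mul_pow, ← Finset.mul_sum]
      ring
    rw [h3]
    refine (hv.1 l hl).2.bdd_mul (c := R ^ 4) ?_ (ae_of_all _ fun ω => ?_)
    · exact ((hc.stronglyMeasurable.mono hm).norm.pow 4).aestronglyMeasurable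
    · simpa using pow_le_pow_left₀ (norm_nonneg _) (hR ω) 4
  · filter_upwards [hv.2 l hl] with ω h n
    simp [h n]

theorem scale_formula (Mo : DistUplinkModel Ω K N L 𝓢) {Lk : Finset (Fin L)}
    {m : MeasurableSpace Ω}
    (hm : m ≤ MeasureSpace.toMeasurableSpace) (k : Fin K)
    {v : Ω → Fin L × Fin N → ℂ} (hv : v ∈ Mo.Vset Lk) {c : Ω → ℂ} (hc : Measurable[m] c)
    {R : ℝ} (hR : ∀ ω, ‖c ω‖ ≤ R) :
    ∀ᵐ ω, (ℙ[Mo.g k (fun ω i => c ω * v ω i) | m]) ω = c ω * (ℙ[Mo.g k v | m]) ω ∧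
      Mo.Dc m (fun ω i => c ω * v ω i) ω = ‖c ω‖ ^ 2 * Mo.Dc m v ω := by
  have hg : ∀ j, Mo.g j (fun ω i => c ω * v ω i) = fun ω => c ω * Mo.g j v ω := by
    intro j
    funext ω
    simp only [g, Finset.mul_sum]
    refine Finset.sum_congr rfl fun i _ => ?_
    ring
  have h1 := condExp_stronglyMeasurable_bilin_of_bound (ContinuousLinearMap.mul ℝ ℂ) hm
    hc.stronglyMeasurable ((Mo.g_L2 hv k).integrable (by norm_num)) R (ae_of_all _ hR)
  have hc2 : StronglyMeasurable[m] fun ω => ‖c ω‖ ^ 2 := (hc.norm.pow_const 2).stronglyMeasurable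
  have hR2 : ∀ ω, ‖‖c ω‖ ^ 2‖ ≤ R ^ 2 := fun ω => by
    simpa using pow_le_pow_left₀ (norm_nonneg _) (hR ω) 2
  have h2 : ∀ᵐ ω, ∀ j, _ := ae_all_iff.2 fun j =>
    condExp_stronglyMeasurable_mul_of_bound hm hc2 (Mo.g_sq_int hv j) _ (ae_of_all _ hR2)
  have h3 := condExp_stronglyMeasurable_mul_of_bound hm hc2 (Mo.v_sq_int hv) _ (ae_of_all _ hR2)
  filter_upwards [h1, h2, h3] with ω h1 h2 h3
  constructor
  · rw [hg]
    simpa using h1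
  · unfold Dc
    have e1 : ∀ j, (fun ω' => ‖Mo.g j (fun ω i => c ω * v ω i) ω'‖ ^ 2) =
        (fun ω => ‖c ω‖ ^ 2) * fun ω => ‖Mo.g j v ω‖ ^ 2 := by
      intro j
      rw [hg]
      funext ω
      simp [mul_pow]
    have e2 : (fun ω' => ∑ i, ‖c ω' * v ω' i‖ ^ 2) =
        (fun ω => ‖c ω‖ ^ 2) * fun ω => ∑ i, ‖v ω i‖ ^ 2 := by
      funext ω
      simp [mul_pow, Finset.mul_sum]
    simp only [e1, e2, h2, h3, Pi.mul_apply, mul_add, Finset.mul_sum]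

theorem Dc_meas (Mo : DistUplinkModel Ω K N L 𝓢) (m : MeasurableSpace Ω)
    (v : Ω → Fin L × Fin N → ℂ) : Measurable[m] (Mo.Dc m v) := by
  unfold Dc
  have h1 : ∀ j, Measurable[m] (ℙ[fun ω' => ‖Mo.g j v ω'‖ ^ 2 | m]) := fun j =>
    (stronglyMeasurable_condExp (m := m)).measurable
  have h2 : Measurable[m] (ℙ[fun ω' => ∑ i, ‖v ω' i‖ ^ 2 | m]) :=
    (stronglyMeasurable_condExp (m := m)).measurable
  exact (Finset.measurable_fun_sum _ fun j _ => h1 j).add h2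

theorem best_scale (Mo : DistUplinkModel Ω K N L 𝓢) {Lk : Finset (Fin L)}
    {m : MeasurableSpace Ω}
    (hm : m ≤ Mo.mG) (hmS : ∀ l ∈ Lk, m ≤ Mo.mS l) (k : Fin K)
    {T : Ω → ℝ} (hT : ∀ v ∈ Mo.Vset Lk, ∀ᵐ ω, T ω ≤ Mo.MSEcond m k v ω)
    {v : Ω → Fin L × Fin N → ℂ} (hv : v ∈ Mo.Vset Lk) :
    ∀ᵐ ω, T ω ≤ 1 - ‖(ℙ[Mo.g k v | m]) ω‖ ^ 2 / Mo.Dc m v ω := by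
  have hm0 := hm.trans Mo.mG_le
  let c0 : Ω → ℂ := fun ω => conj ((ℙ[Mo.g k v | m]) ω) / (Mo.Dc m v ω : ℂ)
  have hc0 : Measurable[m] c0 :=
    (Complex.continuous_conj.measurable.comp stronglyMeasurable_condExp.measurable).div
      (Complex.measurable_ofReal.comp (Mo.Dc_meas m v))
  let c : ℕ → Ω → ℂ := fun n ω => if ‖c0 ω‖ ≤ n then c0 ω else 0
  have hc : ∀ n, Measurable[m] (c n) := fun n =>
    Measurable.ite (hc0.norm measurableSet_Iic) hc0 measurable_const
  have hR : ∀ n ω, ‖c n ω‖ ≤ n := by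
    intro n ω
    simp only [c]
    split_ifs with h
    · exact h
    · simp
  have hmem := fun n => Mo.scale_mem hm0 hmS hv (hc n) (hR n)
  have h1 := ae_all_iff.2 fun n => hT _ (hmem n)
  have h2 := ae_all_iff.2 fun n => Mo.MSE_formula hm k (hmem n)
  have h3 := ae_all_iff.2 fun n => Mo.scale_formula hm0 k hv (hc n) (hR n)
  filter_upwards [h1, h2, h3] with ω h1 h2 h3
  obtain ⟨n, hn⟩ := exists_nat_ge ‖c0 ω‖
  refine (h1 n).trans (le_of_eq ?_)
  rw [h2 n, (h3 n).1, (h3 n).2]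
  have e : c n ω = c0 ω := if_pos hn
  rw [e]
  have e2 : c0 ω * (ℙ[Mo.g k v | m]) ω =
      ((‖(ℙ[Mo.g k v | m]) ω‖ ^ 2 / Mo.Dc m v ω : ℝ) : ℂ) := by
    push_cast
    rw [← Complex.conj_mul']
    simp only [c0]
    ring
  have e3 : ‖c0 ω‖ ^ 2 = ‖(ℙ[Mo.g k v | m]) ω‖ ^ 2 / Mo.Dc m v ω ^ 2 := by
    simp [c0, div_pow]
  rw [e2, e3, Complex.ofReal_re]
  by_cases h0 : Mo.Dc m v ω = 0
  · simp [h0]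
  · field_simp
    ring

end DistUplinkModel


/-- If the decoder side information `U` is common beamforming CSI
(a measurable function of `S_l` for every `l` in the serving cluster) and a measurable
function of `(H, S)`, and if `vopt ∈ 𝒱_k` attains the essential infimum of the family of
conditional MSEs over `𝒱_k`, then `vopt` attains the supremum over `𝒱_k` of the
coherent-decoding ergodic rate `R_k^coh(v) = E[log(1 + SINR_k^coh(v|U))]`
(expectation taken in `[0, ∞]`). -/
theorem conditional_mse_minimizer_maximizes_coherent_rate
    {Ω : Type*} [MeasureSpace Ω] [IsProbabilityMeasure (ℙ : Measure Ω)]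
    {K N L : ℕ} {𝓢 : Fin L → Type*} [∀ l, MeasurableSpace (𝓢 l)]
    {𝓤 : Type*} [MeasurableSpace 𝓤]
    (Mo : DistUplinkModel Ω K N L 𝓢) (Lk : Finset (Fin L)) (k : Fin K)
    (U : Ω → 𝓤) (hU : Measurable U)
    (hUcommon : ∀ l ∈ Lk,
      MeasurableSpace.comap U inferInstance ≤ Mo.mS l)
    (hUHS : MeasurableSpace.comap U inferInstance ≤
      MeasurableSpace.comap (fun ω => (Mo.H ω, fun l => Mo.S l ω)) inferInstance)
    (vopt : Ω → Fin L × Fin N → ℂ) (hvopt : vopt ∈ Mo.Vset Lk)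
    (hmin : ∀ v ∈ Mo.Vset Lk, ∀ᵐ ω,
      Mo.MSEcond (MeasurableSpace.comap U inferInstance) k vopt ω ≤
        Mo.MSEcond (MeasurableSpace.comap U inferInstance) k v ω) :
    ∀ v ∈ Mo.Vset Lk,
      (∫⁻ ω, ENNReal.ofReal (Real.log
          (1 + Mo.SINR_coh (MeasurableSpace.comap U inferInstance) k v ω))) ≤
      ∫⁻ ω, ENNReal.ofReal (Real.log
          (1 + Mo.SINR_coh (MeasurableSpace.comap U inferInstance) k vopt ω)) := by
  intro v hv
  have hm : MeasurableSpace.comap U inferInstance ≤ Mo.mG := hUHS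
  have hm0 := hm.trans Mo.mG_le
  refine lintegral_mono_ae ?_
  filter_upwards [Mo.best_scale hm hUcommon k hmin hv, Mo.MSE_formula hm k hvopt,
    Mo.D_dich hm0 k hv, Mo.D_dich hm0 k hvopt] with ω h1 h2 h3 h4
  rw [Mo.SINR_eq, Mo.SINR_eq]
  rw [h2] at h1
  have h5 := aux_real h3 (sq_nonneg _) (sq_nonneg _) h4
    (by
      rw [← sq_abs]
      exact pow_le_pow_left₀ (abs_nonneg _) (Complex.abs_re_le_norm _) 2) h1 rfl
  refine ENNReal.ofReal_le_ofReal (Real.log_le_log ?_ (by linarith))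
  have : 0 ≤ ‖(ℙ[Mo.g k v | MeasurableSpace.comap U inferInstance]) ω‖ ^ 2 /
      (Mo.Dc (MeasurableSpace.comap U inferInstance) v ω -
        ‖(ℙ[Mo.g k v | MeasurableSpace.comap U inferInstance]) ω‖ ^ 2) := by
    refine div_nonneg (sq_nonneg _) ?_
    rcases h3 with h | ⟨h, h'⟩ <;> linarith
  linarith
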